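/- Let W and W' be non-negative real random variables on the same probability space with the same distribution and let D := W' − W. Then for any positive constants t, k₁, k₂, K₁, K₂, K₃ with k₂ < k₁ and K₂ < K₃, E(D²·1[|W − t| ≤ |D|]) ≤ k₂ + k₁e₂ + e₁ + (E|E(D|W)|/(K₃ − K₂))·( k₂·ln(k₁/k₂) + √(32 t k₂ k₁) + 2K₁ t^{1/2} k₁ + 4K₁√(k₁k₂) + 4K₁ (t k₂ k₁³)^{1/4} ), where e₁ := E[ E(D²|W) · 1[E(D²|W) > k₁ or E(D⁴|W) > k₂(W + t)] ] and e₂ := P[ E(D²|W) < K₃ or E(D⁴|W) > K₁²K₂W ]. -/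

import Mathlib

open MeasureTheory Real

/-- Identically distributed variables whose difference is integrable have the same mean, even if
neither of them is integrable. -/
theorem integral_sub_eq_zero_of_map_eq {Ω : Type*} [MeasurableSpace Ω] {μ : Measure Ω}
    [IsFiniteMeasure μ] {X Y : Ω → ℝ} (hX : Measurable X) (hY : Measurable Y)
    (hX0 : ∀ ω, 0 ≤ X ω) (hY0 : ∀ ω, 0 ≤ Y ω) (hmap : μ.map X = μ.map Y)
    (hfi : Integrable (fun ω => Y ω - X ω) μ) : ∫ ω, (Y ω - X ω) ∂μ = 0 := by
  have hlim : Filter.Tendsto (fun n : ℕ => ∫ ω, (min (Y ω) n - min (X ω) n) ∂μ) Filter.atTop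
      (nhds (∫ ω, (Y ω - X ω) ∂μ)) := by
    refine tendsto_integral_of_dominated_convergence (fun ω => |Y ω - X ω|)
      (fun n => by fun_prop) hfi.abs (fun n => ?_) ?_
    · exact ae_of_all _ fun ω => abs_min_sub_min_le_max _ _ _ _ |>.trans (by simp)
    · refine ae_of_all _ fun ω => tendsto_const_nhds.congr' ?_
      filter_upwards [Filter.eventually_ge_atTop ⌈max (Y ω) (X ω)⌉₊] with n hn
      have h : max (Y ω) (X ω) ≤ n := Nat.ceil_le.1 hn
      rw [min_eq_left ((le_max_left _ _).trans h), min_eq_left ((le_max_right _ _).trans h)]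
  have hzero (n : ℕ) : ∫ ω, (min (Y ω) n - min (X ω) n) ∂μ = 0 := by
    have hb (Z : Ω → ℝ) (hZ : Measurable Z) (hZ0 : ∀ ω, 0 ≤ Z ω) :
        Integrable (fun ω => min (Z ω) (n : ℝ)) μ :=
      Integrable.of_bound (by fun_prop) (n : ℝ) (ae_of_all _ fun ω => by
        rw [Real.norm_of_nonneg (le_min (hZ0 ω) n.cast_nonneg)]
        exact min_le_right _ _)
    have hm (Z : Ω → ℝ) (hZ : Measurable Z) :
        ∫ ω, min (Z ω) (n : ℝ) ∂μ = ∫ x, min x (n : ℝ) ∂(μ.map Z) :=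
      (integral_map hZ.aemeasurable (f := fun x : ℝ => min x (n : ℝ)) (by fun_prop)).symm
    rw [integral_sub (hb Y hY hY0) (hb X hX hX0), hm Y hY, hm X hX, hmap, sub_self]
  simp only [hzero] at hlim
  exact tendsto_nhds_unique hlim tendsto_const_nhds

/-- The truncation of `y` to `[-r, r]`. -/
noncomputable def clip (r y : ℝ) : ℝ := max (-r) (min y r)

/-- The Huber function, whose derivative is `clip r`. -/
noncomputable def huber (r y : ℝ) : ℝ := y * clip r y - clip r y ^ 2 / 2

theorem abs_clip_le {r : ℝ} (hr : 0 ≤ r) (y : ℝ) : |clip r y| ≤ r :=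
  abs_le.2 ⟨le_max_left _ _, max_le (by linarith) (min_le_right _ _)⟩

theorem clip_eq_self {r y : ℝ} (hy : |y| ≤ r) : clip r y = y := by
  rw [clip, min_eq_left (abs_le.1 hy).2, max_eq_right (abs_le.1 hy).1]

theorem mul_sub_sq_le_huber {r a : ℝ} (ha : |a| ≤ r) (y : ℝ) : y * a - a ^ 2 / 2 ≤ huber r y := by
  obtain ⟨h1, h2⟩ := abs_le.1 ha
  rw [huber, clip]
  rcases le_total y r with h | h
  · rw [min_eq_left h]
    rcases le_total (-r) y with h' | h'
    · rw [max_eq_right h']; nlinarith [sq_nonneg (y - a)]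
    · rw [max_eq_left h']; nlinarith
  · rw [min_eq_right h, max_eq_right (by linarith)]; nlinarith

theorem huber_nonneg {r : ℝ} (hr : 0 ≤ r) (y : ℝ) : 0 ≤ huber r y := by
  simpa using mul_sub_sq_le_huber (a := 0) (by simpa using hr) y

theorem huber_add_mul_clip_le {r : ℝ} (hr : 0 ≤ r) (y z : ℝ) :
    huber r y + (z - y) * clip r y ≤ huber r z := by
  have := mul_sub_sq_le_huber (abs_clip_le hr y) z
  rw [huber]; linarith

theorem abs_huber_sub_huber_le {r : ℝ} (hr : 0 ≤ r) (y z : ℝ) :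
    |huber r z - huber r y| ≤ r * |z - y| := by
  have key (a b : ℝ) : (b - a) * clip r a ≥ -(r * |b - a|) := by
    have := neg_abs_le ((b - a) * clip r a)
    rw [abs_mul] at this
    nlinarith [mul_le_mul_of_nonneg_left (abs_clip_le hr a) (abs_nonneg (b - a))]
  have h1 := huber_add_mul_clip_le hr y z
  have h2 := huber_add_mul_clip_le hr z y
  have h3 := key y z
  have h4 := key z y
  rw [abs_sub_comm y z] at h4
  exact abs_le.2 ⟨by linarith, by linarith⟩

@[fun_prop]
theorem measurable_clip (r : ℝ) : Measurable (clip r) := by unfold clip; fun_prop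

@[fun_prop]
theorem measurable_huber (r : ℝ) : Measurable (huber r) := by unfold huber; fun_prop

/-- Taylor's inequality for the Huber function centred in `[p, q]`, averaged over a pair with
equal marginals. -/
theorem integral_sq_indicator_le_mul_integral_abs_condExp
    {Ω : Type*} {m m₀ : MeasurableSpace Ω} {μ : Measure Ω} [IsFiniteMeasure μ] (hm : m ≤ m₀)
    {W W' : Ω → ℝ} (hWm : Measurable[m] W) (hW' : Measurable W')
    (hdist : μ.map W = μ.map W')
    (hD : Integrable (fun ω => W' ω - W ω) μ)
    (hD2 : Integrable (fun ω => (W' ω - W ω) ^ 2) μ)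
    {p q : ℝ} (hpq : p ≤ q) :
    ∫ ω, {ω | W ω ∈ Set.Icc p q ∧ W' ω ∈ Set.Icc p q}.indicator
        (fun ω => (W' ω - W ω) ^ 2) ω ∂μ ≤
      (q - p) * ∫ ω, |(μ[fun ω => W' ω - W ω | m]) ω| ∂μ := by
  have hW : Measurable W := hWm.mono hm le_rfl
  set r := (q - p) / 2 with hr_def
  set a := (p + q) / 2 with ha_def
  have hr : 0 ≤ r := by linarith
  have hcm : StronglyMeasurable[m] (fun ω => clip r (W ω - a)) :=
    ((measurable_clip r).comp (hWm.sub_const a)).stronglyMeasurable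
  have hclipint (f : Ω → ℝ) (hf : Integrable f μ) :
      Integrable (fun ω => clip r (W ω - a) * f ω) μ :=
    hf.bdd_mul (c := r) (hcm.mono hm).aestronglyMeasurable
      (ae_of_all _ fun ω => abs_clip_le hr _)
  have hHint : Integrable (fun ω => huber r (W' ω - a) - huber r (W ω - a)) μ := by
    refine (hD.norm.const_mul r).mono' (by fun_prop) (ae_of_all _ fun ω => ?_)
    simpa using abs_huber_sub_huber_le hr (W ω - a) (W' ω - a)
  have hHzero : ∫ ω, (huber r (W' ω - a) - huber r (W ω - a)) ∂μ = 0 := by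
    refine integral_sub_eq_zero_of_map_eq (by fun_prop) (by fun_prop)
      (fun ω => huber_nonneg hr _) (fun ω => huber_nonneg hr _) ?_ hHint
    have hg : Measurable fun x => huber r (x - a) := by fun_prop
    have := congrArg (Measure.map fun x => huber r (x - a)) hdist
    rwa [Measure.map_map hg hW, Measure.map_map hg hW'] at this
  have hset : MeasurableSet {ω | W ω ∈ Set.Icc p q ∧ W' ω ∈ Set.Icc p q} :=
    (hW measurableSet_Icc).inter (hW' measurableSet_Icc)
  have hlow : ∫ ω, {ω | W ω ∈ Set.Icc p q ∧ W' ω ∈ Set.Icc p q}.indicator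
        (fun ω => (W' ω - W ω) ^ 2) ω ∂μ ≤
      ∫ ω, 2 * ((huber r (W' ω - a) - huber r (W ω - a)) -
        clip r (W ω - a) * (W' ω - W ω)) ∂μ := by
    refine integral_mono (hD2.indicator hset) ((hHint.sub (hclipint _ hD)).const_mul 2)
      fun ω => ?_
    have h := huber_add_mul_clip_le hr (W ω - a) (W' ω - a)
    by_cases hω : ω ∈ {ω | W ω ∈ Set.Icc p q ∧ W' ω ∈ Set.Icc p q}
    · obtain ⟨⟨h1, h2⟩, h3, h4⟩ := hω
      have e1 : clip r (W ω - a) = W ω - a :=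
        clip_eq_self (abs_le.2 ⟨by linarith, by linarith⟩)
      have e2 : clip r (W' ω - a) = W' ω - a :=
        clip_eq_self (abs_le.2 ⟨by linarith, by linarith⟩)
      rw [Set.indicator_of_mem (show ω ∈ {ω | W ω ∈ Set.Icc p q ∧ W' ω ∈ Set.Icc p q} from
        ⟨⟨h1, h2⟩, h3, h4⟩)]
      simp only [huber, e1, e2]
      exact le_of_eq (by ring)
    · rw [Set.indicator_of_notMem hω]
      linarith
  have hcond : ∫ ω, clip r (W ω - a) * (W' ω - W ω) ∂μ =
      ∫ ω, clip r (W ω - a) * (μ[fun ω => W' ω - W ω | m]) ω ∂μ := by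
    rw [← integral_condExp hm]
    exact integral_congr_ae (condExp_mul_of_stronglyMeasurable_left hcm (hclipint _ hD) hD)
  have hup : -∫ ω, clip r (W ω - a) * (μ[fun ω => W' ω - W ω | m]) ω ∂μ ≤
      r * ∫ ω, |(μ[fun ω => W' ω - W ω | m]) ω| ∂μ := by
    rw [← integral_neg, ← integral_const_mul]
    refine integral_mono (hclipint _ integrable_condExp).neg
      (integrable_condExp.abs.const_mul r) fun ω => ?_
    refine (neg_le_abs _).trans ?_
    rw [abs_mul]
    exact mul_le_mul_of_nonneg_right (abs_clip_le hr _) (abs_nonneg _)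
  rw [integral_const_mul, integral_sub hHint (hclipint _ hD), hHzero, hcond] at hlow
  have : (q - p) * ∫ ω, |(μ[fun ω => W' ω - W ω | m]) ω| ∂μ =
    2 * (r * ∫ ω, |(μ[fun ω => W' ω - W ω | m]) ω| ∂μ) := by rw [hr_def]; ring
  linarith

theorem mul_measureReal_le_mul_integral_abs_condExp
    {Ω : Type*} {m m₀ : MeasurableSpace Ω} {μ : Measure Ω} [IsFiniteMeasure μ] (hm : m ≤ m₀)
    {W W' : Ω → ℝ} (hWm : Measurable[m] W) (hW' : Measurable W') (hW0 : ∀ ω, 0 ≤ W ω)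
    (hdist : μ.map W = μ.map W')
    (hD : Integrable (fun ω => W' ω - W ω) μ)
    (hD2 : Integrable (fun ω => (W' ω - W ω) ^ 2) μ)
    (hD4 : Integrable (fun ω => (W' ω - W ω) ^ 4) μ)
    {p q K₁ K₂ K₃ : ℝ} (hpq : p ≤ q) (hK₁ : 0 < K₁) (hK₃ : 0 < K₃)
    {S : Set Ω} (hS : MeasurableSet[m] S)
    (hS2 : ∀ ω ∈ S, K₃ ≤ (μ[fun ω => (W' ω - W ω) ^ 2 | m]) ω)
    (hS4 : ∀ ω ∈ S, (μ[fun ω => (W' ω - W ω) ^ 4 | m]) ω ≤ K₁ ^ 2 * K₂ * W ω)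
    (hSpq : ∀ ω ∈ S, |W' ω - W ω| ≤ K₁ * √(W ω) →
      W ω ∈ Set.Icc p q ∧ W' ω ∈ Set.Icc p q) :
    (K₃ - K₂) * μ.real S ≤ (q - p) * ∫ ω, |(μ[fun ω => W' ω - W ω | m]) ω| ∂μ := by
  have hW : Measurable W := hWm.mono hm le_rfl
  set A : Set Ω := {ω | K₁ * √(W ω) < |W' ω - W ω|} with hA_def
  have hA : MeasurableSet A := measurableSet_lt (by fun_prop) (by fun_prop)
  set T : Ω → ℝ := A.indicator fun ω => (W' ω - W ω) ^ 2 with hT_def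
  have hTint : Integrable T μ := hD2.indicator hA
  have hTmeas : Measurable T := Measurable.indicator (by fun_prop) hA
  have hWT (ω : Ω) : 0 ≤ K₁ ^ 2 * W ω * T ω ∧ K₁ ^ 2 * W ω * T ω ≤ (W' ω - W ω) ^ 4 := by
    have hW0 := hW0 ω
    by_cases hω : ω ∈ A
    · rw [hT_def, Set.indicator_of_mem hω]
      have h : (K₁ * √(W ω)) ^ 2 ≤ |W' ω - W ω| ^ 2 :=
        pow_le_pow_left₀ (by positivity) (le_of_lt hω) 2
      rw [mul_pow, sq_sqrt hW0, sq_abs] at h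
      refine ⟨by positivity, ?_⟩
      nlinarith [sq_nonneg (W' ω - W ω)]
    · rw [hT_def, Set.indicator_of_notMem hω]
      exact ⟨by simp, by rw [mul_zero]; positivity⟩
  have hWTint : Integrable ((fun ω => K₁ ^ 2 * W ω) * T) μ :=
    hD4.mono' (by fun_prop) (ae_of_all _ fun ω => by
      simp only [Pi.mul_apply]
      rw [Real.norm_of_nonneg (hWT ω).1]
      exact (hWT ω).2)
  have hpull := condExp_mul_of_stronglyMeasurable_left
    (hWm.const_mul (K₁ ^ 2)).stronglyMeasurable hWTint hTint
  have hmono : μ[(fun ω => K₁ ^ 2 * W ω) * T | m] ≤ᵐ[μ] μ[fun ω => (W' ω - W ω) ^ 4 | m] :=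
    condExp_mono hWTint hD4 (ae_of_all _ fun ω => (hWT ω).2)
  have hzero : μ[fun ω => (W' ω - W ω) ^ 2 | m] ≤ᵐ[μ]
      fun ω => K₃ / 2 + 1 / (2 * K₃) * (μ[fun ω => (W' ω - W ω) ^ 4 | m]) ω := by
    have h1 : μ[fun ω => (W' ω - W ω) ^ 2 | m] ≤ᵐ[μ]
        μ[(fun _ => K₃ / 2) + (1 / (2 * K₃)) • fun ω => (W' ω - W ω) ^ 4 | m] := by
      refine condExp_mono hD2 ((integrable_const _).add (hD4.smul _)) (ae_of_all _ fun ω => ?_)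
      simp only [Pi.add_apply, Pi.smul_apply, smul_eq_mul]
      have : K₃ / 2 + 1 / (2 * K₃) * (W' ω - W ω) ^ 4 - (W' ω - W ω) ^ 2 =
          ((W' ω - W ω) ^ 2 - K₃) ^ 2 / (2 * K₃) := by field_simp; ring
      have : 0 ≤ ((W' ω - W ω) ^ 2 - K₃) ^ 2 / (2 * K₃) := by positivity
      linarith
    filter_upwards [h1, condExp_add (integrable_const (K₃ / 2)) (hD4.smul (1 / (2 * K₃))) m,
      condExp_smul (μ := μ) (1 / (2 * K₃)) (fun ω => (W' ω - W ω) ^ 4) m] with ω h1 h2 h3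
    rw [h2, Pi.add_apply, h3, condExp_const hm] at h1
    simpa using h1
  have hTle : ∀ᵐ ω ∂μ, ω ∈ S → (μ[T | m]) ω ≤ K₂ := by
    filter_upwards [hpull, hmono, hzero] with ω h1 h2 h3 hω
    have h4 := hS4 ω hω
    have h5 := hS2 ω hω
    rcases (hW0 ω).eq_or_lt with h0 | h0
    · rw [← h0, mul_zero] at h4
      have : 1 / (2 * K₃) * (μ[fun ω => (W' ω - W ω) ^ 4 | m]) ω ≤ 0 :=
        mul_nonpos_of_nonneg_of_nonpos (by positivity) h4
      linarith
    · rw [h1, Pi.mul_apply] at h2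
      have : K₁ ^ 2 * W ω * (μ[T | m]) ω ≤ K₁ ^ 2 * W ω * K₂ := by linarith
      exact le_of_mul_le_mul_left this (by positivity)
  have hlow : K₃ * μ.real S ≤ ∫ ω in S, (W' ω - W ω) ^ 2 ∂μ := by
    rw [← setIntegral_condExp hm hD2 hS, mul_comm, ← smul_eq_mul, ← setIntegral_const]
    exact setIntegral_mono_on (integrable_const _) integrable_condExp.integrableOn (hm _ hS) hS2
  have hTup : ∫ ω in S, T ω ∂μ ≤ K₂ * μ.real S := by
    rw [← setIntegral_condExp hm hTint hS, mul_comm, ← smul_eq_mul, ← setIntegral_const]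
    exact setIntegral_mono_on_ae integrable_condExp.integrableOn (integrable_const _)
      (hm _ hS) hTle
  have hrest : ∫ ω in S, ((W' ω - W ω) ^ 2 - T ω) ∂μ ≤
      (q - p) * ∫ ω, |(μ[fun ω => W' ω - W ω | m]) ω| ∂μ := by
    refine le_trans ?_
      (integral_sq_indicator_le_mul_integral_abs_condExp hm hWm hW' hdist hD hD2 hpq)
    rw [← integral_indicator (hm _ hS)]
    refine integral_mono ((hD2.sub hTint).indicator (hm _ hS))
      (hD2.indicator ((hW measurableSet_Icc).inter (hW' measurableSet_Icc))) fun ω => ?_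
    by_cases hω : ω ∈ S
    · rw [Set.indicator_of_mem hω]
      by_cases hωA : ω ∈ A
      · simp only [hT_def, Set.indicator_of_mem hωA, sub_self]
        exact Set.indicator_nonneg (fun _ _ => sq_nonneg _) _
      · simp only [hT_def, Set.indicator_of_notMem hωA, sub_zero]
        have hmem : ω ∈ {ω | W ω ∈ Set.Icc p q ∧ W' ω ∈ Set.Icc p q} :=
          hSpq ω hω (not_lt.1 hωA)
        rw [Set.indicator_of_mem hmem]
    · rw [Set.indicator_of_notMem hω]
      exact Set.indicator_nonneg (fun _ _ => sq_nonneg _) _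
  rw [integral_sub hD2.integrableOn hTint.integrableOn] at hrest
  linarith

theorem mem_Icc_of_mul_sq_sub_le {t b w : ℝ} (ht : 0 ≤ t) (hb : 0 ≤ b)
    (h : (w - t) ^ 2 ≤ b * (w + t)) :
    w ∈ Set.Icc (t - √(2 * t * b)) (t + b + √(2 * t * b)) := by
  have hs : √(2 * t * b) ^ 2 = 2 * t * b := sq_sqrt (by positivity)
  have hs0 := sqrt_nonneg (2 * t * b)
  constructor
  · by_contra! hlt
    nlinarith
  · by_contra! hlt
    nlinarith

/-- The positive part of `w - K * √w` is monotone in `w ≥ 0`. -/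
theorem sub_mul_sqrt_le {K l w x : ℝ} (hl : 0 ≤ l) (hlw : l ≤ w) (hx0 : 0 ≤ x)
    (hx : w - K * √w ≤ x) : l - K * √l ≤ x := by
  have h1 := sqrt_le_sqrt hlw
  have h2 := sq_sqrt hl
  have h3 := sq_sqrt (hl.trans hlw)
  have h4 := sqrt_nonneg l
  rcases le_total (√l) K with h | h
  · nlinarith
  · nlinarith

theorem exists_Icc_of_mul_sq_sub_le {t c k K : ℝ} (ht : 0 ≤ t) (hc : 0 < c) (hk : 0 ≤ k)
    (hK : 0 ≤ K) :
    ∃ p q : ℝ, p ≤ q ∧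
      q - p ≤ k * c⁻¹ + (2 * √(2 * t * k) + K * √k) * (√c)⁻¹ + 2 * K * √t ∧
      ∀ w x : ℝ, 0 ≤ w → 0 ≤ x → c * (w - t) ^ 2 ≤ k * (w + t) → |x - w| ≤ K * √w →
        w ∈ Set.Icc p q ∧ x ∈ Set.Icc p q := by
  obtain ⟨b, hb⟩ : ∃ b, b = k / c := ⟨_, rfl⟩
  have hb0 : 0 ≤ b := hb ▸ by positivity
  set s := √(2 * t * b) with hs_def
  have hs0 : 0 ≤ s := sqrt_nonneg _
  have hlt : max (t - s) 0 ≤ t := max_le (by linarith) ht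
  have hl0 : 0 ≤ max (t - s) 0 := le_max_right _ _
  have hsqrt : √(t + b + s) ≤ √t + √b := by
    rw [sqrt_le_left (by positivity), add_sq, sq_sqrt ht, sq_sqrt hb0]
    have : s ≤ 2 * √t * √b := by
      rw [hs_def, sqrt_le_left (by positivity), mul_pow, mul_pow, sq_sqrt ht, sq_sqrt hb0]
      nlinarith [mul_nonneg ht hb0]
    linarith
  refine ⟨max (t - s) 0 - K * √(max (t - s) 0), t + b + s + K * √(t + b + s), ?_, ?_, ?_⟩
  · have := mul_nonneg hK (sqrt_nonneg (max (t - s) 0))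
    have := mul_nonneg hK (sqrt_nonneg (t + b + s))
    linarith
  · have h1 : s = √(2 * t * k) * (√c)⁻¹ := by
      rw [hs_def, hb, ← mul_div_assoc, sqrt_div (by positivity), div_eq_mul_inv]
    have h2 : √b = √k * (√c)⁻¹ := by rw [hb, sqrt_div hk, div_eq_mul_inv]
    have h3 : t - s ≤ max (t - s) 0 := le_max_left _ _
    have h4 := mul_le_mul_of_nonneg_left (sqrt_le_sqrt hlt) hK
    have h5 := mul_le_mul_of_nonneg_left hsqrt hK
    have h6 : k * c⁻¹ + (2 * √(2 * t * k) + K * √k) * (√c)⁻¹ + 2 * K * √t =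
        b + 2 * s + K * √b + 2 * K * √t := by
      rw [h1, h2, hb, div_eq_mul_inv]; ring
    rw [h6]
    linarith
  · have key (w x : ℝ) (hw : 0 ≤ w) (hx : 0 ≤ x) (h : c * (w - t) ^ 2 ≤ k * (w + t))
        (hxw : |x - w| ≤ K * √w) :
        x ∈ Set.Icc (max (t - s) 0 - K * √(max (t - s) 0)) (t + b + s + K * √(t + b + s)) := by
      have hwb : (w - t) ^ 2 ≤ b * (w + t) := by
        rw [hb, div_mul_eq_mul_div, le_div_iff₀ hc]; linarith
      obtain ⟨h1, h2⟩ := mem_Icc_of_mul_sq_sub_le ht hb0 hwb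
      obtain ⟨h3, h4⟩ := abs_le.1 hxw
      refine ⟨sub_mul_sqrt_le hl0 (max_le h1 hw) hx (by linarith), ?_⟩
      have := mul_le_mul_of_nonneg_left (sqrt_le_sqrt h2) hK
      linarith
    exact fun w x hw hx h hxw => ⟨key w w hw hw h (by simpa using by positivity),
      key w x hw hx h hxw⟩

theorem integral_inv_add_inv_sqrt {a b : ℝ} (ha : 0 < a) (hab : a ≤ b) (A B C : ℝ) :
    IntervalIntegrable (fun c => A * c⁻¹ + B * (√c)⁻¹ + C) volume a b ∧
    ∫ c in a..b, (A * c⁻¹ + B * (√c)⁻¹ + C) =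
      A * log (b / a) + 2 * B * (√b - √a) + C * (b - a) := by
  have hpos : ∀ c ∈ Set.uIcc a b, 0 < c := fun c hc => by
    rw [Set.uIcc_of_le hab] at hc
    exact ha.trans_le hc.1
  have hfi : IntervalIntegrable (fun c => A * c⁻¹ + B * (√c)⁻¹ + C) volume a b := by
    refine ContinuousOn.intervalIntegrable ?_
    refine ((continuousOn_const.mul (continuousOn_id.inv₀ fun c hc => (hpos c hc).ne')).add
      (continuousOn_const.mul (continuous_sqrt.continuousOn.inv₀ fun c hc =>
        (sqrt_pos.2 (hpos c hc)).ne'))).add continuousOn_const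
  refine ⟨hfi, ?_⟩
  rw [intervalIntegral.integral_eq_sub_of_hasDerivAt
    (f := fun c => A * log c + 2 * B * √c + C * c) (fun c hc => ?_) hfi]
  · rw [log_div (ha.trans_le hab).ne' ha.ne']; ring
  · have h0 := (hpos c hc).ne'
    refine ((((hasDerivAt_log h0).const_mul A).add
      ((hasDerivAt_sqrt h0).const_mul (2 * B))).add
        ((hasDerivAt_id c).const_mul C)).congr_deriv ?_
    field_simp

/-- The largest `v ≤ k₁` with `(w - t) ^ 2 * v ≤ k₂ * (w + t)`. -/
noncomputable def truncatedRatio (t k₁ k₂ w : ℝ) : ℝ :=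
  if k₁ * (w - t) ^ 2 ≤ k₂ * (w + t) then k₁ else k₂ * (w + t) / (w - t) ^ 2

@[fun_prop]
theorem measurable_truncatedRatio (t k₁ k₂ : ℝ) : Measurable (truncatedRatio t k₁ k₂) :=
  Measurable.ite (measurableSet_le (by fun_prop) (by fun_prop)) (by fun_prop) (by fun_prop)

theorem sq_sub_pos_of_lt {t k₁ k₂ w : ℝ} (ht : 0 ≤ t) (hk₂ : 0 ≤ k₂) (hw : 0 ≤ w)
    (h : k₂ * (w + t) < k₁ * (w - t) ^ 2) : 0 < (w - t) ^ 2 := by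
  refine (sq_nonneg _).lt_of_ne fun h0 => ?_
  rw [← h0, mul_zero] at h
  exact h.not_ge (by positivity)

theorem truncatedRatio_le {t k₁ k₂ w : ℝ} (ht : 0 ≤ t) (hk₂ : 0 ≤ k₂) (hw : 0 ≤ w) :
    truncatedRatio t k₁ k₂ w ≤ k₁ := by
  rw [truncatedRatio]
  split_ifs with h
  · exact le_rfl
  · rw [not_le] at h
    rw [div_le_iff₀ (sq_sub_pos_of_lt ht hk₂ hw h)]
    exact h.le

theorem le_truncatedRatio {t k₁ k₂ w v : ℝ} (ht : 0 ≤ t) (hk₂ : 0 ≤ k₂) (hw : 0 ≤ w)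
    (h₁ : v ≤ k₁) (h₂ : (w - t) ^ 2 * v ≤ k₂ * (w + t)) : v ≤ truncatedRatio t k₁ k₂ w := by
  rw [truncatedRatio]
  split_ifs with h
  · exact h₁
  · rw [not_le] at h
    rw [le_div_iff₀ (sq_sub_pos_of_lt ht hk₂ hw h)]
    linarith

theorem mul_sq_sub_le_of_le_truncatedRatio {t k₁ k₂ w c : ℝ} (ht : 0 ≤ t) (hk₂ : 0 ≤ k₂)
    (hw : 0 ≤ w) (h : c ≤ truncatedRatio t k₁ k₂ w) : c * (w - t) ^ 2 ≤ k₂ * (w + t) := by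
  rw [truncatedRatio] at h
  split_ifs at h with h'
  · exact (mul_le_mul_of_nonneg_right h (sq_nonneg _)).trans h'
  · rw [not_le] at h'
    exact (le_div_iff₀ (sq_sub_pos_of_lt ht hk₂ hw h')).1 h

theorem integral_sq_mul_indicator_le
    {Ω : Type*} {m m₀ : MeasurableSpace Ω} {μ : Measure Ω} [IsProbabilityMeasure μ] (hm : m ≤ m₀)
    {W W' : Ω → ℝ} (hWm : Measurable[m] W) (hW' : Measurable W')
    (hW0 : ∀ ω, 0 ≤ W ω) (hW'0 : ∀ ω, 0 ≤ W' ω)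
    (hdist : μ.map W = μ.map W')
    (hD : Integrable (fun ω => W' ω - W ω) μ)
    (hD2 : Integrable (fun ω => (W' ω - W ω) ^ 2) μ)
    (hD4 : Integrable (fun ω => (W' ω - W ω) ^ 4) μ)
    {t k₁ k₂ K₁ K₂ K₃ : ℝ} (ht : 0 < t) (hk₂ : 0 < k₂) (hK₁ : 0 < K₁)
    (hK₃ : 0 < K₃) (hkk : k₂ < k₁) (hKK : K₂ < K₃) :
    ∫ ω, (W' ω - W ω) ^ 2 * {ω | |W ω - t| ≤ |W' ω - W ω|}.indicator (fun _ => (1 : ℝ)) ω ∂μ ≤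
      k₂ + k₁ * μ.real {ω | (μ[fun ω => (W' ω - W ω) ^ 2 | m]) ω < K₃ ∨
        K₁ ^ 2 * K₂ * W ω < (μ[fun ω => (W' ω - W ω) ^ 4 | m]) ω}
      + ∫ ω, (μ[fun ω => (W' ω - W ω) ^ 2 | m]) ω *
          {ω | k₁ < (μ[fun ω => (W' ω - W ω) ^ 2 | m]) ω ∨
            k₂ * (W ω + t) < (μ[fun ω => (W' ω - W ω) ^ 4 | m]) ω}.indicator
              (fun _ => (1 : ℝ)) ω ∂μ
      + (∫ ω, |(μ[fun ω => W' ω - W ω | m]) ω| ∂μ) / (K₃ - K₂) *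
          (k₂ * log (k₁ / k₂) + √(32 * t * k₂ * k₁) + 2 * K₁ * √t * k₁
            + 2 * K₁ * √(k₁ * k₂)) := by
  have hW : Measurable W := hWm.mono hm le_rfl
  set P2 := μ[fun ω => (W' ω - W ω) ^ 2 | m] with hP2
  set P4 := μ[fun ω => (W' ω - W ω) ^ 4 | m]
  set δ := ∫ ω, |(μ[fun ω => W' ω - W ω | m]) ω| ∂μ
  have hP2m : Measurable[m] P2 := stronglyMeasurable_condExp.measurable
  have hP4m : Measurable[m] P4 := stronglyMeasurable_condExp.measurable
  set B1 := {ω | k₁ < P2 ω ∨ k₂ * (W ω + t) < P4 ω} with hB1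
  set B2 := {ω | P2 ω < K₃ ∨ K₁ ^ 2 * K₂ * W ω < P4 ω} with hB2
  have hB1m : MeasurableSet[m] B1 := (measurableSet_lt measurable_const hP2m).union
    (measurableSet_lt ((hWm.add_const t).const_mul k₂) hP4m)
  have hB2m : MeasurableSet[m] B2 := (measurableSet_lt hP2m measurable_const).union
    (measurableSet_lt (hWm.const_mul _) hP4m)
  have hδ0 : 0 ≤ δ := integral_nonneg fun ω => abs_nonneg _
  set N := {ω | |W ω - t| ≤ |W' ω - W ω|}
  have hNm : MeasurableSet N := measurableSet_le (by fun_prop) (by fun_prop)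
  set Y : Ω → ℝ := fun ω => (W' ω - W ω) ^ 2 * N.indicator (fun _ => (1 : ℝ)) ω with hY
  have hYeq : Y = N.indicator fun ω => (W' ω - W ω) ^ 2 := by
    ext ω; by_cases h : ω ∈ N <;> simp [hY, h]
  have hYint : Integrable Y μ := hYeq ▸ hD2.indicator hNm
  have hYmeas : Measurable Y := hYeq ▸ Measurable.indicator (by fun_prop) hNm
  have hY0 (ω : Ω) : 0 ≤ Y ω := hYeq ▸ Set.indicator_nonneg (fun _ _ => sq_nonneg _) _
  have hY2 (ω : Ω) : Y ω ≤ (W' ω - W ω) ^ 2 :=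
    hYeq ▸ Set.indicator_le_self' (fun _ _ => sq_nonneg _) _
  have hY4 (ω : Ω) : (W ω - t) ^ 2 * Y ω ≤ (W' ω - W ω) ^ 4 := by
    by_cases h : ω ∈ N
    · have h' : (W ω - t) ^ 2 ≤ (W' ω - W ω) ^ 2 := sq_le_sq.2 h
      simp only [hYeq, Set.indicator_of_mem h]
      nlinarith [sq_nonneg (W' ω - W ω)]
    · simp only [hYeq, Set.indicator_of_notMem h, mul_zero]
      positivity
  have hWYint : Integrable ((fun ω => (W ω - t) ^ 2) * Y) μ :=
    hD4.mono' (by fun_prop) (ae_of_all _ fun ω => by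
      simp only [Pi.mul_apply]
      rw [Real.norm_of_nonneg (mul_nonneg (sq_nonneg _) (hY0 ω))]
      exact hY4 ω)
  have hV2 : μ[Y | m] ≤ᵐ[μ] P2 := condExp_mono hYint hD2 (ae_of_all _ hY2)
  have hV4 : μ[(fun ω => (W ω - t) ^ 2) * Y | m] ≤ᵐ[μ] P4 :=
    condExp_mono hWYint hD4 (ae_of_all _ hY4)
  have hpull := condExp_mul_of_stronglyMeasurable_left
    ((hWm.sub_const t).pow_const 2).stronglyMeasurable hWYint hYint
  have hP2nn : 0 ≤ᵐ[μ] P2 := condExp_nonneg (ae_of_all _ fun ω => sq_nonneg _)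
  set X : Ω → ℝ := B2ᶜ.indicator fun ω => max (truncatedRatio t k₁ k₂ (W ω) - k₂) 0 with hX
  have hXm : Measurable[m] X :=
    Measurable.indicator ((((measurable_truncatedRatio t k₁ k₂).comp hWm).sub_const k₂).max
      measurable_const) hB2m.compl
  have hX0 (ω : Ω) : 0 ≤ X ω := Set.indicator_nonneg (fun _ _ => le_max_right _ _) _
  have hXle (ω : Ω) : X ω ≤ k₁ - k₂ :=
    Set.indicator_le' (fun ω _ => max_le
      (sub_le_sub_right (truncatedRatio_le ht.le hk₂.le (hW0 ω)) _) (by linarith))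
      (fun _ _ => by linarith) ω
  have hXint : Integrable X μ :=
    Integrable.of_bound (hXm.mono hm le_rfl).aestronglyMeasurable (k₁ - k₂)
      (ae_of_all _ fun ω => by rw [Real.norm_of_nonneg (hX0 ω)]; exact hXle ω)
  have hlayer (s : ℝ) (hs : 0 < s) : μ.real {ω | s ≤ X ω} ≤ δ / (K₃ - K₂) *
      (k₂ * (k₂ + s)⁻¹ + (2 * √(2 * t * k₂) + K₁ * √k₂) * (√(k₂ + s))⁻¹ + 2 * K₁ * √t) := by
    obtain ⟨p, q, hpq, hlen, hmem⟩ :=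
      exists_Icc_of_mul_sq_sub_le ht.le (add_pos hk₂ hs) hk₂.le hK₁.le
    have hS (ω : Ω) (hω : ω ∈ {ω | s ≤ X ω}) :
        ω ∉ B2 ∧ k₂ + s ≤ truncatedRatio t k₁ k₂ (W ω) := by
      rw [Set.mem_ofPred_eq] at hω
      have hωB : ω ∉ B2 := fun h => by
        rw [hX, Set.indicator_of_notMem (by simpa using h)] at hω
        linarith
      rw [hX, Set.indicator_of_mem hωB] at hω
      rcases le_max_iff.1 hω with h | h
      · exact ⟨hωB, by linarith⟩
      · linarith
    have h := mul_measureReal_le_mul_integral_abs_condExp (K₂ := K₂) hm hWm hW' hW0 hdist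
      hD hD2 hD4 hpq hK₁ hK₃ (S := {ω | s ≤ X ω}) (hXm measurableSet_Ici)
      (fun ω hω => not_lt.1 fun h => (hS ω hω).1 (Or.inl h))
      (fun ω hω => not_lt.1 fun h => (hS ω hω).1 (Or.inr h))
      (fun ω hω => hmem _ _ (hW0 ω) (hW'0 ω)
        (mul_sq_sub_le_of_le_truncatedRatio ht.le hk₂.le (hW0 ω) (hS ω hω).2))
    rw [div_mul_eq_mul_div, le_div_iff₀ (sub_pos.2 hKK)]
    nlinarith [mul_le_mul_of_nonneg_right hlen hδ0]
  have hXbound : ∫ ω, X ω ∂μ ≤ δ / (K₃ - K₂) *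
      (k₂ * log (k₁ / k₂) + √(32 * t * k₂ * k₁) + 2 * K₁ * √t * k₁
        + 2 * K₁ * √(k₁ * k₂)) := by
    obtain ⟨hfi, hval⟩ := integral_inv_add_inv_sqrt hk₂ hkk.le k₂
      (2 * √(2 * t * k₂) + K₁ * √k₂) (2 * K₁ * √t)
    have hfi' := hfi.comp_add_left k₂
    rw [sub_self] at hfi'
    rw [hXint.integral_eq_integral_Ioc_meas_le (ae_of_all _ hX0) (ae_of_all _ hXle)]
    refine (integral_mono_of_nonneg (ae_of_all _ fun s => measureReal_nonneg)
      (((intervalIntegrable_iff_integrableOn_Ioc_of_le (by linarith)).1 hfi').const_mul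
        (δ / (K₃ - K₂)))
      ((ae_restrict_iff' measurableSet_Ioc).2 (ae_of_all _ fun s hs => hlayer s hs.1))).trans ?_
    rw [integral_const_mul, ← intervalIntegral.integral_of_le (by linarith),
      intervalIntegral.integral_comp_add_left (fun c => k₂ * c⁻¹ +
        (2 * √(2 * t * k₂) + K₁ * √k₂) * (√c)⁻¹ + 2 * K₁ * √t) k₂,
      add_zero, add_sub_cancel, hval]
    refine mul_le_mul_of_nonneg_left ?_ (div_nonneg hδ0 (sub_pos.2 hKK).le)
    have e1 : √(32 * t * k₂ * k₁) = 4 * √(2 * t * k₂) * √k₁ := by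
      rw [show 32 * t * k₂ * k₁ = 4 ^ 2 * ((2 * t * k₂) * k₁) by ring,
        sqrt_mul (by norm_num), sqrt_sq (by norm_num), sqrt_mul (by positivity)]
      ring
    have e2 : √(k₁ * k₂) = √k₁ * √k₂ := sqrt_mul (hk₂.trans hkk).le _
    have e3 : 0 ≤ √(2 * t * k₂) * √k₂ := by positivity
    have e4 : 0 ≤ K₁ * √k₂ * √k₂ := by positivity
    have e5 : 0 ≤ K₁ * √t * k₂ := by positivity
    rw [e1, e2]
    linarith
  have hP2B : Integrable (fun ω => P2 ω * B1.indicator (fun _ => (1 : ℝ)) ω) μ := by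
    refine ((integrable_condExp (μ := μ) (m := m)
      (f := fun ω => (W' ω - W ω) ^ 2)).indicator (hm _ hB1m)).congr (ae_of_all _ fun ω => ?_)
    by_cases h : ω ∈ B1 <;> simp [h, hP2]
  have hBint : Integrable (B2.indicator fun _ => k₁) μ :=
    (integrable_const k₁).indicator (hm _ hB2m)
  have hpt : μ[Y | m] ≤ᵐ[μ] fun ω => k₂ + B2.indicator (fun _ => k₁) ω +
      P2 ω * B1.indicator (fun _ => (1 : ℝ)) ω + X ω := by
    filter_upwards [hV2, hV4, hpull, hP2nn] with ω h2 h4 hp h0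
    have hX0 := hX0 ω
    have hk₁ : 0 < k₁ := hk₂.trans hkk
    have hB20 : 0 ≤ B2.indicator (fun _ => k₁) ω := Set.indicator_nonneg (fun _ _ => hk₁.le) _
    by_cases hω : ω ∈ B1
    · rw [Set.indicator_of_mem hω]
      linarith
    · have hω' : P2 ω ≤ k₁ ∧ P4 ω ≤ k₂ * (W ω + t) := by
        simpa [hB1, not_or] using hω
      rw [hp, Pi.mul_apply] at h4
      have hg := le_truncatedRatio ht.le hk₂.le (hW0 ω) (h2.trans hω'.1) (h4.trans hω'.2)
      rw [Set.indicator_of_notMem hω, mul_zero]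
      by_cases hω2 : ω ∈ B2
      · rw [Set.indicator_of_mem hω2]
        linarith [hω'.1]
      · have : truncatedRatio t k₁ k₂ (W ω) - k₂ ≤ X ω := by
          rw [hX, Set.indicator_of_mem (show ω ∈ B2ᶜ from hω2)]
          exact le_max_left _ _
        linarith
  have hsum₂ : Integrable (fun ω => k₂ + B2.indicator (fun _ => k₁) ω) μ :=
    (integrable_const k₂).add hBint
  have hsum₃ : Integrable (fun ω => k₂ + B2.indicator (fun _ => k₁) ω +
      P2 ω * B1.indicator (fun _ => (1 : ℝ)) ω) μ := hsum₂.add hP2B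
  have hfinal := integral_mono_ae integrable_condExp (hsum₃.add hXint) hpt
  rw [integral_condExp hm, integral_add' hsum₃ hXint, integral_add hsum₂ hP2B,
    integral_add (integrable_const k₂) hBint, integral_indicator (hm _ hB2m),
    setIntegral_const] at hfinal
  simp only [integral_const, probReal_univ, smul_eq_mul, one_mul] at hfinal
  linarith

/-- Theorem 2.3 (tool2). -/
theorem tool2
    {Ω : Type*} [MeasurableSpace Ω] {μ : Measure Ω} [IsProbabilityMeasure μ]
    (W W' : Ω → ℝ) (hW : Measurable W) (hW' : Measurable W')
    (hWnn : ∀ ω, 0 ≤ W ω) (hW'nn : ∀ ω, 0 ≤ W' ω)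
    (hdist : μ.map W = μ.map W')
    (D : Ω → ℝ) (hDdef : D = fun ω => W' ω - W ω)
    (hD1 : Integrable D μ)
    (hD2 : Integrable (fun ω => (D ω) ^ 2) μ)
    (hD4 : Integrable (fun ω => (D ω) ^ 4) μ)
    (t k₁ k₂ K₁ K₂ K₃ : ℝ)
    (ht : 0 < t) (hk₁ : 0 < k₁) (hk₂ : 0 < k₂) (hK₁ : 0 < K₁) (hK₂ : 0 < K₂) (hK₃ : 0 < K₃)
    (hkk : k₂ < k₁) (hKK : K₂ < K₃) :
    (∫ ω, (D ω) ^ 2 * Set.indicator {ω' | |W ω' - t| ≤ |D ω'|} (fun _ => (1 : ℝ)) ω ∂μ) ≤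
      k₂
      + k₁ * (μ {ω | (μ[(fun ω' => (D ω') ^ 2) | MeasurableSpace.comap W inferInstance]) ω < K₃ ∨
            K₁ ^ 2 * K₂ * W ω <
              (μ[(fun ω' => (D ω') ^ 4) | MeasurableSpace.comap W inferInstance]) ω}).toReal
      + (∫ ω, (μ[(fun ω' => (D ω') ^ 2) | MeasurableSpace.comap W inferInstance]) ω *
          Set.indicator
            {ω' | k₁ < (μ[(fun ω'' => (D ω'') ^ 2) | MeasurableSpace.comap W inferInstance]) ω' ∨
              k₂ * (W ω' + t) <
                (μ[(fun ω'' => (D ω'') ^ 4) | MeasurableSpace.comap W inferInstance]) ω'}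
            (fun _ => (1 : ℝ)) ω ∂μ)
      + ((∫ ω, |(μ[D | MeasurableSpace.comap W inferInstance]) ω| ∂μ) / (K₃ - K₂)) *
          (k₂ * Real.log (k₁ / k₂) + Real.sqrt (32 * t * k₂ * k₁) + 2 * K₁ * Real.sqrt t * k₁
            + 4 * K₁ * Real.sqrt (k₁ * k₂) + 4 * K₁ * (t * k₂ * k₁ ^ 3) ^ ((1 : ℝ) / 4)) := by
  subst hDdef
  refine (integral_sq_mul_indicator_le hW.comap_le (comap_measurable W) hW' hWnn hW'nn hdist
    hD1 hD2 hD4 ht hk₂ hK₁ hK₃ hkk hKK).trans ?_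
  refine add_le_add_right (mul_le_mul_of_nonneg_left ?_
    (div_nonneg (integral_nonneg fun ω => abs_nonneg _) (sub_pos.2 hKK).le)) _
  have h1 : 0 ≤ K₁ * √(k₁ * k₂) := by positivity
  have h2 : 0 ≤ 4 * K₁ * (t * k₂ * k₁ ^ 3) ^ ((1 : ℝ) / 4) := by positivity
  linarith
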